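/- arXiv:1904.03507 — 6 statements merged into one kernel-verified Lean document; each statement's English description precedes it below -/
import Mathlib

section
/- Let 0 < α, α ≠ 1, and let a, b : ℕ → ℝ be two non-negative, non-increasing sequences such that ∑ₖ aₖ^α < ∞, ∑ₖ bₖ^α < ∞, ∑ₖ aₖ = ∑ₖ bₖ < ∞, and for every m ∈ ℕ the partial sums satisfy ∑_{k≤m} aₖ ≥ ∑_{k≤m} bₖ (i.e., a majorizes b). Then the Rényi entropies satisfy S^α(a) ≤ S^α(b); equivalently, if α < 1 then ∑ₖ aₖ^α ≤ ∑ₖ bₖ^α, and if α > 1 then ∑ₖ aₖ^α ≥ ∑ₖ bₖ^α. -/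
/-- Abel summation bound: against weights `c` that decrease up to index `n`, a sequence `d` with
non-negative partial sums satisfies `c n * ∑ k ≤ n, d k ≤ ∑ k ≤ n, c k * d k`. -/
theorem mul_sum_range_succ_le_sum_mul (c d : ℕ → ℝ) (n : ℕ)
    (hc : ∀ k < n, c (k + 1) ≤ c k) (hd : ∀ m, 0 ≤ ∑ k ∈ Finset.range (m + 1), d k) :
    c n * ∑ k ∈ Finset.range (n + 1), d k ≤ ∑ k ∈ Finset.range (n + 1), c k * d k := by
  induction n with
  | zero => simp
  | succ n ih =>
    have h1 := ih fun k hk => hc k (by omega)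
    have h2 := mul_le_mul_of_nonneg_right (hc n (by omega)) (hd n)
    rw [Finset.sum_range_succ, Finset.sum_range_succ (fun k => c k * d k), mul_add]
    linarith

theorem Real.rpow_eq_rpow_mul_one_add_rpow {α x y : ℝ} (hx : 0 ≤ x) (hy : 0 < y) :
    x ^ α = y ^ α * (1 + (x - y) / y) ^ α := by
  have h : 1 + (x - y) / y = x / y := by field_simp; ring
  rw [h, ← Real.mul_rpow hy.le (by positivity), mul_div_cancel₀ _ hy.ne']

theorem Real.rpow_mul_one_add_mul_div {α x y : ℝ} (hy : 0 < y) :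
    y ^ α * (1 + α * ((x - y) / y)) = y ^ α + α * (y ^ (α - 1) * (x - y)) := by
  rw [Real.rpow_sub_one hy.ne']
  field_simp

theorem Real.rpow_add_mul_sub_le_rpow {α x y : ℝ} (hα : 1 < α) (hx : 0 ≤ x) (hy : 0 ≤ y) :
    y ^ α + α * (y ^ (α - 1) * (x - y)) ≤ x ^ α := by
  rcases hy.eq_or_lt with rfl | hy
  · rw [Real.zero_rpow (by linarith), Real.zero_rpow (by linarith)]
    simpa using Real.rpow_nonneg hx α
  · rw [← Real.rpow_mul_one_add_mul_div hy, Real.rpow_eq_rpow_mul_one_add_rpow hx hy]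
    refine mul_le_mul_of_nonneg_left (one_add_mul_self_le_rpow_one_add ?_ hα.le) (by positivity)
    rw [le_div_iff₀ hy]
    linarith

theorem Real.rpow_le_rpow_add_mul_sub {α x y : ℝ} (hα0 : 0 < α) (hα1 : α < 1) (hx : 0 ≤ x)
    (hy : 0 < y) : x ^ α ≤ y ^ α + α * (y ^ (α - 1) * (x - y)) := by
  rw [← Real.rpow_mul_one_add_mul_div hy, Real.rpow_eq_rpow_mul_one_add_rpow hx hy]
  refine mul_le_mul_of_nonneg_left
    (rpow_one_add_le_one_add_mul_self ?_ hα0.le hα1.le) (by positivity)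
  rw [le_div_iff₀ hy]
  linarith

section Majorization

variable {α : ℝ} {a b : ℕ → ℝ}

theorem tsum_rpow_le_tsum_rpow_of_one_lt (hα : 1 < α)
    (ha0 : ∀ k, 0 ≤ a k) (hb0 : ∀ k, 0 ≤ b k) (hbmono : Antitone b)
    (haα : Summable fun k => a k ^ α) (hbα : Summable fun k => b k ^ α)
    (hmaj : ∀ m : ℕ, ∑ k ∈ Finset.range (m + 1), b k ≤ ∑ k ∈ Finset.range (m + 1), a k) :
    ∑' k, b k ^ α ≤ ∑' k, a k ^ α := by
  refine le_of_tendsto_of_tendsto'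
    ((Filter.tendsto_add_atTop_iff_nat 1).2 hbα.hasSum.tendsto_sum_nat)
    ((Filter.tendsto_add_atTop_iff_nat 1).2 haα.hasSum.tendsto_sum_nat) fun n => ?_
  have hd : ∀ m, 0 ≤ ∑ k ∈ Finset.range (m + 1), (a k - b k) := fun m => by
    rw [Finset.sum_sub_distrib]
    linarith [hmaj m]
  have h1 := mul_sum_range_succ_le_sum_mul (fun k => b k ^ (α - 1)) (fun k => a k - b k) n
    (fun k _ => Real.rpow_le_rpow (hb0 _) (hbmono k.le_succ) (by linarith)) hd
  have h2 := (mul_nonneg (Real.rpow_nonneg (hb0 n) (α - 1)) (hd n)).trans h1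
  have h3 := Finset.sum_le_sum fun k (_ : k ∈ Finset.range (n + 1)) =>
    Real.rpow_add_mul_sub_le_rpow hα (ha0 k) (hb0 k)
  rw [Finset.sum_add_distrib, ← Finset.mul_sum] at h3
  linarith [mul_nonneg (zero_le_one.trans hα.le) h2]

theorem rpow_sub_one_mul_tsum_le (hα1 : α < 1)
    (hb0 : ∀ k, 0 ≤ b k) (hbmono : Antitone b) (hbα : Summable fun k => b k ^ α)
    (hbSum : Summable b) (n : ℕ) :
    b n ^ (α - 1) * ∑' k, b (k + (n + 1)) ≤ ∑' k, b (k + (n + 1)) ^ α := by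
  rw [← tsum_mul_left]
  refine Summable.tsum_le_tsum (fun k => ?_)
    (((summable_nat_add_iff (n + 1)).2 hbSum).mul_left _) ((summable_nat_add_iff (n + 1)).2 hbα)
  rcases (hb0 (k + (n + 1))).eq_or_lt with h | h
  · rw [← h, mul_zero]
    exact Real.rpow_nonneg le_rfl _
  · calc b n ^ (α - 1) * b (k + (n + 1))
        ≤ b (k + (n + 1)) ^ (α - 1) * b (k + (n + 1)) :=
          mul_le_mul_of_nonneg_right
            (Real.rpow_le_rpow_of_nonpos h (hbmono (by omega)) (by linarith)) h.le
      _ = b (k + (n + 1)) ^ α := by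
          rw [Real.rpow_sub_one h.ne', div_mul_cancel₀ _ h.ne']

theorem sum_range_rpow_le_add_tsum (hα0 : 0 < α) (hα1 : α < 1)
    (ha0 : ∀ k, 0 ≤ a k) (hb0 : ∀ k, 0 ≤ b k) (hbmono : Antitone b)
    (hbα : Summable fun k => b k ^ α) (haSum : Summable a) (hbSum : Summable b)
    (hsum : ∑' k, a k = ∑' k, b k)
    (hmaj : ∀ m : ℕ, ∑ k ∈ Finset.range (m + 1), b k ≤ ∑ k ∈ Finset.range (m + 1), a k)
    (n : ℕ) (hn : 0 < b n) :
    ∑ k ∈ Finset.range (n + 1), a k ^ α ≤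
      ∑ k ∈ Finset.range (n + 1), b k ^ α + α * ∑' k, b (k + (n + 1)) ^ α := by
  have hpos : ∀ k ≤ n, 0 < b k := fun k hk => hn.trans_le (hbmono hk)
  have h1 := mul_sum_range_succ_le_sum_mul (fun k => -b k ^ (α - 1)) (fun k => a k - b k) n
    (fun k hk => neg_le_neg
      (Real.rpow_le_rpow_of_nonpos (hpos _ hk) (hbmono k.le_succ) (by linarith)))
    (fun m => by rw [Finset.sum_sub_distrib]; linarith [hmaj m])
  simp only [neg_mul, Finset.sum_neg_distrib] at h1
  have h2 : ∑ k ∈ Finset.range (n + 1), (a k - b k) ≤ ∑' k, b (k + (n + 1)) := by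
    rw [Finset.sum_sub_distrib]
    linarith [haSum.sum_le_tsum (Finset.range (n + 1)) (fun k _ => ha0 k),
      hbSum.sum_add_tsum_nat_add (n + 1)]
  have h3 := mul_le_mul_of_nonneg_left h2 (Real.rpow_nonneg (hb0 n) (α - 1))
  have h4 := rpow_sub_one_mul_tsum_le hα1 hb0 hbmono hbα hbSum n
  have h5 := Finset.sum_le_sum fun k (hk : k ∈ Finset.range (n + 1)) =>
    Real.rpow_le_rpow_add_mul_sub hα0 hα1 (ha0 k)
      (hpos k (Nat.lt_succ_iff.1 (Finset.mem_range.1 hk)))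
  rw [Finset.sum_add_distrib, ← Finset.mul_sum] at h5
  refine h5.trans (add_le_add_right (mul_le_mul_of_nonneg_left ?_ hα0.le) _)
  linarith

/-- A non-negative sequence majorizing `b` vanishes beyond the support of `b`. -/
theorem eq_zero_of_majorizes (ha0 : ∀ k, 0 ≤ a k) (haSum : Summable a)
    (hsum : ∑' k, a k = ∑' k, b k) {N : ℕ} (hN : ∀ k, N ≤ k → b k = 0)
    (hmaj : ∀ m : ℕ, ∑ k ∈ Finset.range (m + 1), b k ≤ ∑ k ∈ Finset.range (m + 1), a k)
    {k : ℕ} (hk : N ≤ k) : a k = 0 := by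
  have hb : ∑' k, b k = ∑ j ∈ Finset.range N, b j :=
    tsum_eq_sum fun j hj => hN j (by simpa using hj)
  have h1 : ∑ j ∈ Finset.range N, b j ≤ ∑ j ∈ Finset.range N, a j := by
    rcases N with _ | m
    · simp
    · exact hmaj m
  have h2 := haSum.sum_le_tsum (insert k (Finset.range N)) (fun j _ => ha0 j)
  rw [Finset.sum_insert (by simpa using hk)] at h2
  linarith [ha0 k]

theorem tsum_rpow_le_tsum_rpow_of_lt_one (hα0 : 0 < α) (hα1 : α < 1)
    (ha0 : ∀ k, 0 ≤ a k) (hb0 : ∀ k, 0 ≤ b k) (hbmono : Antitone b)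
    (haα : Summable fun k => a k ^ α) (hbα : Summable fun k => b k ^ α)
    (haSum : Summable a) (hbSum : Summable b) (hsum : ∑' k, a k = ∑' k, b k)
    (hmaj : ∀ m : ℕ, ∑ k ∈ Finset.range (m + 1), b k ≤ ∑ k ∈ Finset.range (m + 1), a k) :
    ∑' k, a k ^ α ≤ ∑' k, b k ^ α := by
  have key := sum_range_rpow_le_add_tsum hα0 hα1 ha0 hb0 hbmono hbα haSum hbSum hsum hmaj
  by_cases hpos : ∀ n, 0 < b n
  · have hlim := ((Filter.tendsto_add_atTop_iff_nat 1).2 hbα.hasSum.tendsto_sum_nat).add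
      (((Filter.tendsto_add_atTop_iff_nat 1).2
        (tendsto_sum_nat_add fun k => b k ^ α)).const_mul α)
    rw [mul_zero, add_zero] at hlim
    exact le_of_tendsto_of_tendsto'
      ((Filter.tendsto_add_atTop_iff_nat 1).2 haα.hasSum.tendsto_sum_nat) hlim
      fun n => key n (hpos n)
  · push Not at hpos
    classical
    have hfind := Nat.find_spec hpos
    have hmin : ∀ k < Nat.find hpos, 0 < b k := fun k hk => not_le.1 (Nat.find_min hpos hk)
    generalize Nat.find hpos = N at hfind hmin
    have hbN : ∀ k, N ≤ k → b k = 0 := fun k hk =>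
      le_antisymm ((hbmono hk).trans hfind) (hb0 k)
    have haN : ∀ k, N ≤ k → a k = 0 := fun k hk =>
      eq_zero_of_majorizes ha0 haSum hsum hbN hmaj hk
    have hzero : ∀ c : ℕ → ℝ, (∀ k, N ≤ k → c k = 0) →
        ∑' k, c k ^ α = ∑ k ∈ Finset.range N, c k ^ α := fun c hc =>
      tsum_eq_sum fun k hk => by rw [hc k (by simpa using hk), Real.zero_rpow hα0.ne']
    rw [hzero a haN, hzero b hbN]
    rcases N with _ | m
    · simp
    · have h0 : ∑' k, b (k + (m + 1)) ^ α = 0 := by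
        simp [hbN _ (Nat.le_add_left (m + 1) _), Real.zero_rpow hα0.ne']
      simpa [h0] using key m (hmin m m.lt_succ_self)

end Majorization

theorem tsum_rpow_pos {α : ℝ} {p : ℕ → ℝ} (hp0 : ∀ k, 0 ≤ p k)
    (hpα : Summable fun k => p k ^ α) (hp : ∑' k, p k ≠ 0) : 0 < ∑' k, p k ^ α := by
  obtain ⟨k, hk⟩ : ∃ k, p k ≠ 0 := by
    by_contra! h
    exact hp (by simp [h])
  exact hpα.tsum_pos (fun j => Real.rpow_nonneg (hp0 j) α) k
    (Real.rpow_pos_of_pos ((hp0 k).lt_of_ne' hk) α)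

/-- Schur-concavity of the Rényi entropy for infinite sequences (Lemma 3.2):
if `a` majorizes `b` (same total sum, larger partial sums), then
`S^α(a) ≤ S^α(b)` where `S^α(p) = (1/(1-α)) * log₂ (∑ₖ pₖ^α)`. -/
theorem renyi_entropy_schur_concave
    (α : ℝ) (hα0 : 0 < α) (hα1 : α ≠ 1)
    (a b : ℕ → ℝ)
    (ha0 : ∀ k, 0 ≤ a k) (hb0 : ∀ k, 0 ≤ b k)
    (hamono : Antitone a) (hbmono : Antitone b)
    (haα : Summable fun k => a k ^ α)
    (hbα : Summable fun k => b k ^ α)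
    (haSum : Summable a) (hbSum : Summable b)
    (hsum : ∑' k, a k = ∑' k, b k)
    (hmaj : ∀ m : ℕ, ∑ k ∈ Finset.range (m + 1), b k ≤ ∑ k ∈ Finset.range (m + 1), a k) :
    (1 / (1 - α)) * Real.logb 2 (∑' k, a k ^ α) ≤
      (1 / (1 - α)) * Real.logb 2 (∑' k, b k ^ α) := by
  by_cases h0 : ∑' k, a k = 0
  · have ha : a = 0 := (hasSum_zero_iff_of_nonneg ha0).1 (h0 ▸ haSum.hasSum)
    have hb : b = 0 := (hasSum_zero_iff_of_nonneg hb0).1 ((hsum.symm.trans h0) ▸ hbSum.hasSum)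
    rw [ha, hb]
  · rcases hα1.lt_or_gt with h | h
    · exact mul_le_mul_of_nonneg_left
        (Real.logb_le_logb_of_le one_lt_two (tsum_rpow_pos ha0 haα h0)
          (tsum_rpow_le_tsum_rpow_of_lt_one hα0 h ha0 hb0 hbmono haα hbα haSum hbSum hsum hmaj))
        (one_div_nonneg.2 (by linarith))
    · exact mul_le_mul_of_nonpos_left
        (Real.logb_le_logb_of_le one_lt_two (tsum_rpow_pos hb0 hbα (hsum ▸ h0))
          (tsum_rpow_le_tsum_rpow_of_one_lt h ha0 hb0 hbmono haα hbα hmaj))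
        (one_div_nonpos.2 (by linarith))
end

section
/- Let 0 < α < 1 and let σ : ℕ → ℝ be a non-negative, non-increasing sequence with ∑ₖ σₖ² = 1 and ∑ₖ (σₖ²)^α < ∞. For an integer r ≥ 2, set ε²(r) := ∑_{k>r} σₖ² and assume ε²(r) > 0. Then the Rényi entropy of the sequence (σₖ²) satisfies S^α((σₖ²)) ≥ (α/(1−α))·log₂(ε²(r)/α) + log₂((r−1)/(1−α)). -/
/-- Weighted AM-GM in the form that minimizes `a * h ^ α + b * h ^ (α - 1)` over `h > 0`. -/
theorem rpow_mul_rpow_le_add_rpow {α a b h : ℝ} (hα0 : 0 < α) (hα1 : α < 1)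
    (ha : 0 ≤ a) (hb : 0 ≤ b) (hh : 0 < h) :
    (b / α) ^ α * (a / (1 - α)) ^ (1 - α) ≤ a * h ^ α + b * h ^ (α - 1) := by
  have hβ : 0 < 1 - α := sub_pos.2 hα1
  have key := Real.geom_mean_le_arith_mean2_weighted hα0.le hβ.le
    (p₁ := b / α * h ^ (α - 1)) (p₂ := a / (1 - α) * h ^ α)
    (by positivity) (by positivity) (by ring)
  rw [Real.mul_rpow (by positivity) (by positivity), Real.mul_rpow (by positivity) (by positivity),
    ← Real.rpow_mul hh.le, ← Real.rpow_mul hh.le] at key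
  have hcancel : h ^ ((α - 1) * α) * h ^ (α * (1 - α)) = 1 := by
    rw [← Real.rpow_add hh, show (α - 1) * α + α * (1 - α) = 0 by ring, Real.rpow_zero]
  calc (b / α) ^ α * (a / (1 - α)) ^ (1 - α)
      = (b / α) ^ α * (a / (1 - α)) ^ (1 - α) * (h ^ ((α - 1) * α) * h ^ (α * (1 - α))) := by
        rw [hcancel, mul_one]
    _ = (b / α) ^ α * h ^ ((α - 1) * α) * ((a / (1 - α)) ^ (1 - α) * h ^ (α * (1 - α))) := by ring
    _ ≤ _ := key
    _ = a * h ^ α + b * h ^ (α - 1) := by field_simp; ring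

/-- For an antitone non-negative sequence and `0 < α < 1`, the sum of the `α`-th powers is bounded
below in terms of the number of leading terms and the mass of the tail. -/
theorem Antitone.rpow_mul_rpow_le_tsum_rpow {α : ℝ} (hα0 : 0 < α) (hα1 : α < 1)
    {p : ℕ → ℝ} (hp0 : ∀ k, 0 ≤ p k) (hp : Antitone p)
    (hpα : Summable fun k => p k ^ α) (n : ℕ) (hε : 0 < ∑' k, p (k + (n + 1))) :
    ((∑' k, p (k + (n + 1))) / α) ^ α * ((n : ℝ) / (1 - α)) ^ (1 - α) ≤ ∑' k, p k ^ α := by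
  have hpn : 0 < p n := by
    refine (hp0 n).lt_of_ne fun h => hε.ne' ?_
    have hz : ∀ k, p (k + (n + 1)) = 0 := fun k =>
      le_antisymm (h ▸ hp (by omega)) (hp0 _)
    simp [hz]
  have hhead : (n : ℝ) * p n ^ α ≤ ∑ k ∈ Finset.range (n + 1), p k ^ α := by
    calc (n : ℝ) * p n ^ α ≤ ((n + 1 : ℕ) : ℝ) * p n ^ α := by
          gcongr
          exact n.le_succ
      _ = ∑ _k ∈ Finset.range (n + 1), p n ^ α := by simp
      _ ≤ _ := Finset.sum_le_sum fun k hk =>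
          Real.rpow_le_rpow hpn.le (hp (Finset.mem_range_succ_iff.1 hk)) hα0.le
  have hsum : Summable fun k => p (k + (n + 1)) := by
    by_contra h
    exact hε.ne' (tsum_eq_zero_of_not_summable h)
  have htail : (∑' k, p (k + (n + 1))) * p n ^ (α - 1) ≤ ∑' k, p (k + (n + 1)) ^ α := by
    rw [← tsum_mul_right]
    refine (hsum.mul_right _).tsum_le_tsum (fun k => ?_) ((summable_nat_add_iff (n + 1)).2 hpα)
    rcases (hp0 (k + (n + 1))).eq_or_lt with h | h
    · rw [← h, zero_mul, Real.zero_rpow hα0.ne']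
    · calc p (k + (n + 1)) * p n ^ (α - 1)
          ≤ p (k + (n + 1)) * p (k + (n + 1)) ^ (α - 1) :=
            mul_le_mul_of_nonneg_left
              (Real.rpow_le_rpow_of_nonpos h (hp (by omega)) (by linarith)) h.le
        _ = p (k + (n + 1)) ^ α := by
            rw [Real.rpow_sub_one h.ne', mul_div_cancel₀ _ h.ne']
  rw [← hpα.sum_add_tsum_nat_add (n + 1)]
  exact (rpow_mul_rpow_le_add_rpow hα0 hα1 n.cast_nonneg hε.le hpn).trans (add_le_add hhead htail)

/-- Proposition 3.1, case `0 < α < 1`: lower bound on the Rényi entropy of the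
squared singular value sequence in terms of the truncation error
`ε²(r) = ∑_{k>r} σₖ²` (the tail after the first `r` terms). -/
theorem renyi_entropy_lower_bound
    (α : ℝ) (hα0 : 0 < α) (hα1 : α < 1)
    (σ : ℕ → ℝ) (hσ0 : ∀ k, 0 ≤ σ k) (hσmono : Antitone σ)
    (hσsum : ∑' k, σ k ^ 2 = 1)
    (hσα : Summable fun k => (σ k ^ 2) ^ α)
    (r : ℕ) (hr : 2 ≤ r)
    (hε : 0 < ∑' k, σ (k + r) ^ 2) :
    (1 / (1 - α)) * Real.logb 2 (∑' k, (σ k ^ 2) ^ α) ≥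
      (α / (1 - α)) * Real.logb 2 ((∑' k, σ (k + r) ^ 2) / α) +
        Real.logb 2 (((r : ℝ) - 1) / (1 - α)) := by
  obtain ⟨n, rfl⟩ : ∃ n, r = n + 1 := ⟨r - 1, by omega⟩
  have hβ : 0 < 1 - α := sub_pos.2 hα1
  have hn : (0 : ℝ) < n := by exact_mod_cast (by omega : 0 < n)
  have hmono : Antitone fun k => σ k ^ 2 := fun i j hij =>
    pow_le_pow_left₀ (hσ0 j) (hσmono hij) 2
  have key := hmono.rpow_mul_rpow_le_tsum_rpow hα0 hα1 (fun k => sq_nonneg (σ k)) hσα n hε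
  have hx : 0 < (∑' k, σ (k + (n + 1)) ^ 2) / α := div_pos hε hα0
  have hy : 0 < (n : ℝ) / (1 - α) := div_pos hn hβ
  have hlog := Real.logb_le_logb_of_le one_lt_two
    (mul_pos (Real.rpow_pos_of_pos hx α) (Real.rpow_pos_of_pos hy (1 - α))) key
  rw [Real.logb_mul (Real.rpow_pos_of_pos hx α).ne' (Real.rpow_pos_of_pos hy (1 - α)).ne',
    Real.logb_rpow_eq_mul_logb_of_pos hx, Real.logb_rpow_eq_mul_logb_of_pos hy] at hlog
  rw [Nat.cast_succ, add_sub_cancel_right, ge_iff_le]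
  calc _ = 1 / (1 - α) * (α * Real.logb 2 ((∑' k, σ (k + (n + 1)) ^ 2) / α) +
        (1 - α) * Real.logb 2 ((n : ℝ) / (1 - α))) := by field_simp
    _ ≤ _ := mul_le_mul_of_nonneg_left hlog (by positivity)
end

section
/- Let α > 1 and let σ : ℕ → ℝ be a non-negative, non-increasing sequence with ∑ₖ σₖ² = 1. For an integer r ≥ 1, set ε²(r) := ∑_{k>r} σₖ² and assume ε²(r) < 1. Then the Rényi entropy of the sequence (σₖ²) satisfies S^α((σₖ²)) ≤ (α/(1−α))·log₂(1−ε²(r)) + log₂(r). -/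
/-- Proposition 3.1, case `α > 1`: upper bound on the Rényi entropy of the
squared singular value sequence in terms of the truncation error
`ε²(r) = ∑_{k>r} σₖ²` (the tail after the first `r` terms). -/
theorem renyi_entropy_upper_bound
    (α : ℝ) (hα : 1 < α)
    (σ : ℕ → ℝ) (hσ0 : ∀ k, 0 ≤ σ k) (hσmono : Antitone σ)
    (hσsum : ∑' k, σ k ^ 2 = 1)
    (r : ℕ) (hr : 1 ≤ r)
    (hε : ∑' k, σ (k + r) ^ 2 < 1) :
    (1 / (1 - α)) * Real.logb 2 (∑' k, (σ k ^ 2) ^ α) ≤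
      (α / (1 - α)) * Real.logb 2 (1 - ∑' k, σ (k + r) ^ 2) + Real.logb 2 (r : ℝ) := by
  have hsum : Summable fun k => σ k ^ 2 := by
    by_contra h
    simp [tsum_eq_zero_of_not_summable h] at hσsum
  have hle (k : ℕ) : σ k ^ 2 ≤ 1 := hσsum ▸ hsum.le_tsum k fun j _ => sq_nonneg _
  have hsumα : Summable fun k => (σ k ^ 2) ^ α :=
    hsum.of_nonneg_of_le (fun k => by positivity) fun k =>
      Real.rpow_le_self_of_le_one (sq_nonneg _) (hle k) hα.le
  have hhead : 1 - ∑' k, σ (k + r) ^ 2 = ∑ k ∈ Finset.range r, σ k ^ 2 := by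
    linarith [hsum.sum_add_tsum_nat_add r]
  have hhead_pos : 0 < ∑ k ∈ Finset.range r, σ k ^ 2 := by linarith
  have hr_pos : (0 : ℝ) < r := by exact_mod_cast hr
  have hpow : (∑ k ∈ Finset.range r, σ k ^ 2) ^ α ≤
      (r : ℝ) ^ (α - 1) * ∑' k, (σ k ^ 2) ^ α := by
    calc (∑ k ∈ Finset.range r, σ k ^ 2) ^ α
        ≤ (r : ℝ) ^ (α - 1) * ∑ k ∈ Finset.range r, (σ k ^ 2) ^ α := by
          simpa using Real.rpow_sum_le_const_mul_sum_rpow_of_nonneg (Finset.range r)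
            (f := fun k => σ k ^ 2) hα.le fun k _ => sq_nonneg _
      _ ≤ _ := by
          gcongr
          exact hsumα.sum_le_tsum _ fun k _ => by positivity
  have hrα : 0 < (r : ℝ) ^ (α - 1) := Real.rpow_pos_of_pos hr_pos _
  have hT : 0 < ∑' k, (σ k ^ 2) ^ α :=
    pos_of_mul_pos_right ((Real.rpow_pos_of_pos hhead_pos α).trans_le hpow) hrα.le
  have hlog := Real.logb_le_logb_of_le (b := 2) (by norm_num)
    (Real.rpow_pos_of_pos hhead_pos α) hpow
  rw [Real.logb_mul hrα.ne' hT.ne', Real.logb_rpow_eq_mul_logb_of_pos hhead_pos,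
    Real.logb_rpow_eq_mul_logb_of_pos hr_pos] at hlog
  rw [hhead, div_mul_eq_mul_div, div_mul_eq_mul_div, div_add' _ _ _ (by linarith : 1 - α ≠ 0),
    div_le_div_right_of_neg (by linarith)]
  linarith
end

section
/- Let λ : ℕ → ℝ be a non-decreasing sequence with λₖ → ∞ such that ∑ₖ exp(−β·λₖ) converges for every β > 0, and let E(β) := (∑ₖ exp(−β·λₖ)·λₖ)/(∑ₖ exp(−β·λₖ)). Then E(β) → ∞ as β → 0⁺. -/
/-- Half of the Boltzmann weight absorbs the linear factor, so the energy series converges. -/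
theorem summable_exp_neg_mul_mul {lam : ℕ → ℝ}
    (htend : Filter.Tendsto lam Filter.atTop Filter.atTop)
    (hZ : ∀ β : ℝ, 0 < β → Summable fun k => Real.exp (-β * lam k)) {β : ℝ} (hβ : 0 < β) :
    Summable fun k => Real.exp (-β * lam k) * lam k := by
  refine Summable.of_norm_bounded_eventually_nat ((hZ (β / 2) (by positivity)).mul_left (2 / β)) ?_
  filter_upwards [htend.eventually_ge_atTop 0] with k hk
  rw [Real.norm_of_nonneg (by positivity)]
  have hlam : lam k ≤ 2 / β * Real.exp (β / 2 * lam k) := by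
    have h := Real.add_one_le_exp (β / 2 * lam k)
    calc lam k = 2 / β * (β / 2 * lam k) := by field_simp
      _ ≤ 2 / β * Real.exp (β / 2 * lam k) := by gcongr; linarith
  calc Real.exp (-β * lam k) * lam k
      ≤ Real.exp (-β * lam k) * (2 / β * Real.exp (β / 2 * lam k)) := by gcongr
    _ = 2 / β * (Real.exp (-β * lam k) * Real.exp (β / 2 * lam k)) := by ring
    _ = 2 / β * Real.exp (-(β / 2) * lam k) := by rw [← Real.exp_add]; ring_nf

/-- If `f` tends to `∞`, some partial sum of `f` that includes all negative terms is positive. -/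
theorem exists_sum_range_pos_of_tendsto_atTop {f : ℕ → ℝ}
    (hf : Filter.Tendsto f Filter.atTop Filter.atTop) :
    ∃ K, 0 < ∑ k ∈ Finset.range K, f k ∧ ∀ k, K ≤ k → 0 ≤ f k := by
  obtain ⟨N, hN⟩ := Filter.eventually_atTop.1 (hf.eventually_ge_atTop 1)
  obtain ⟨m, hm⟩ := exists_nat_gt (-∑ k ∈ Finset.range N, f k)
  refine ⟨N + m, ?_, fun k hk => zero_le_one.trans (hN k (by omega))⟩
  have h : (m : ℝ) ≤ ∑ k ∈ Finset.range m, f (N + k) := by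
    simpa using Finset.card_nsmul_le_sum (Finset.range m) (fun k => f (N + k)) 1
      fun k _ => hN (N + k) (by omega)
  rw [Finset.sum_range_add]
  linarith

/-- High-temperature half of step IV of Proposition 3.4: the Gibbs expected
energy `E(β)` tends to `∞` as `β → 0⁺`. -/
theorem gibbs_energy_tendsto_atTop
    (lam : ℕ → ℝ) (hmono : Monotone lam)
    (htend : Filter.Tendsto lam Filter.atTop Filter.atTop)
    (hZ : ∀ β : ℝ, 0 < β → Summable fun k => Real.exp (-β * lam k)) :
    Filter.Tendsto
      (fun β : ℝ => (∑' k, Real.exp (-β * lam k) * lam k) / (∑' k, Real.exp (-β * lam k)))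
      (nhdsWithin 0 (Set.Ioi 0)) Filter.atTop := by
  refine Filter.tendsto_atTop.2 fun C => ?_
  obtain ⟨K, hK, hnonneg⟩ := exists_sum_range_pos_of_tendsto_atTop
    (Filter.tendsto_atTop_add_const_right _ (-C) htend)
  have hcont : Continuous fun β : ℝ =>
      ∑ k ∈ Finset.range K, Real.exp (-β * lam k) * (lam k + -C) := by fun_prop
  have hpos : ∀ᶠ β in nhdsWithin (0 : ℝ) (Set.Ioi 0),
      0 < ∑ k ∈ Finset.range K, Real.exp (-β * lam k) * (lam k + -C) :=
    nhdsWithin_le_nhds (hcont.continuousAt.eventually_const_lt (by simpa using hK))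
  filter_upwards [hpos, self_mem_nhdsWithin] with β hβK hβ
  have hE := summable_exp_neg_mul_mul htend hZ hβ
  have hsub := hE.hasSum.add ((hZ β hβ).hasSum.mul_right (-C))
  simp only [← mul_add] at hsub
  have hle := sum_le_hasSum (Finset.range K) (fun k hk =>
    mul_nonneg (Real.exp_pos _).le (hnonneg k (by simpa using hk))) hsub
  rw [le_div_iff₀ ((hZ β hβ).tsum_pos (fun k => (Real.exp_pos _).le) 0 (Real.exp_pos _))]
  linarith
end

section
/- Let 0 < α < 1, let d ≥ 2 be a natural number, let j ≥ 1 be a natural number, and set p := 1/d. Then (1/(1−α))·log₂((1−p)^α + 2^{(1−α)·j}·p^α) ≥ j − (α/(1−α))·log₂ d. -/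
/-- Rényi entropy computation for the example state `ψ_{2d}` with `p = 1/d`:
`(1/(1−α)) log₂((1−p)^α + 2^{(1−α)j} p^α) ≥ j − (α/(1−α)) log₂ d`. -/
theorem example_state_renyi_lower_bound
    (α : ℝ) (hα0 : 0 < α) (hα1 : α < 1)
    (d j : ℕ) (hd : 2 ≤ d) (hj : 1 ≤ j) :
    (1 / (1 - α)) *
        Real.logb 2
          ((1 - 1 / (d : ℝ)) ^ α + (2 : ℝ) ^ ((1 - α) * (j : ℝ)) * (1 / (d : ℝ)) ^ α) ≥
      (j : ℝ) - (α / (1 - α)) * Real.logb 2 (d : ℝ) := by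
  have hd0 : (0 : ℝ) < d := by positivity
  have hα : 0 < 1 - α := by linarith
  have hp : (0 : ℝ) ≤ 1 - 1 / (d : ℝ) := by
    rw [sub_nonneg, div_le_one hd0]
    exact_mod_cast (by omega : 1 ≤ d)
  have h2 : (0 : ℝ) < (2 : ℝ) ^ ((1 - α) * (j : ℝ)) := by positivity
  have hdα : (0 : ℝ) < (1 / (d : ℝ)) ^ α := by positivity
  have hlog : Real.logb 2 ((2 : ℝ) ^ ((1 - α) * (j : ℝ)) * (1 / (d : ℝ)) ^ α) =
      (1 - α) * j - α * Real.logb 2 d := by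
    rw [Real.logb_mul h2.ne' hdα.ne', Real.logb_rpow (by norm_num) (by norm_num),
      Real.logb_rpow_eq_mul_logb_of_pos (by positivity), one_div, Real.logb_inv]
    ring
  have hmono : Real.logb 2 ((2 : ℝ) ^ ((1 - α) * (j : ℝ)) * (1 / (d : ℝ)) ^ α) ≤
      Real.logb 2
        ((1 - 1 / (d : ℝ)) ^ α + (2 : ℝ) ^ ((1 - α) * (j : ℝ)) * (1 / (d : ℝ)) ^ α) :=
    Real.logb_le_logb_of_le (by norm_num) (by positivity)
      (le_add_of_nonneg_left (Real.rpow_nonneg hp α))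
  calc (j : ℝ) - (α / (1 - α)) * Real.logb 2 (d : ℝ)
      = (1 / (1 - α)) * ((1 - α) * j - α * Real.logb 2 d) := by field_simp
    _ ≤ _ := by
      rw [← hlog]
      exact mul_le_mul_of_nonneg_left hmono (by positivity)
end

section
/- Let ε ∈ [0, 1/2), and let E, E_B, E_LR be real numbers with 0 ≤ E_B ≤ 1, 0 ≤ E_LR ≤ 1, E_LR ≥ 1 − 2ε, and E ≥ E_B·E_LR − √(E_B·(1−E_B))·√(E_LR·(1−E_LR)) − ε. Then E_B·(1 − 2ε) ≤ E + √(2·E_B·ε) + ε. -/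
/-- The algebraic core of the bound relating `E_B` to the factorized expectation
`E` (Lemma following Lemma 4.8): from the Cauchy–Schwarz covariance bound and
`E_LR ≥ 1 − 2ε` one gets `E_B (1 − 2ε) ≤ E + √(2 E_B ε) + ε`. -/
theorem expectation_value_bound
    (ε E EB ELR : ℝ) (hε0 : 0 ≤ ε) (hε : ε < 1 / 2)
    (hEB0 : 0 ≤ EB) (hEB1 : EB ≤ 1)
    (hELR0 : 0 ≤ ELR) (hELR1 : ELR ≤ 1)
    (hELR : 1 - 2 * ε ≤ ELR)
    (hE : EB * ELR - Real.sqrt (EB * (1 - EB)) * Real.sqrt (ELR * (1 - ELR)) - ε ≤ E) :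
    EB * (1 - 2 * ε) ≤ E + Real.sqrt (2 * EB * ε) + ε := by
  have hLR : ELR * (1 - ELR) ≤ 2 * ε := by nlinarith
  have hB : EB * (1 - EB) ≤ EB := by nlinarith
  have hsqrt : Real.sqrt (EB * (1 - EB)) * Real.sqrt (ELR * (1 - ELR)) ≤
      Real.sqrt (2 * EB * ε) :=
    calc Real.sqrt (EB * (1 - EB)) * Real.sqrt (ELR * (1 - ELR))
        ≤ Real.sqrt EB * Real.sqrt (2 * ε) := by gcongr
      _ = Real.sqrt (2 * EB * ε) := by
        rw [← Real.sqrt_mul hEB0]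
        ring_nf
  have hmul : EB * (1 - 2 * ε) ≤ EB * ELR := mul_le_mul_of_nonneg_left hELR hEB0
  linarith
end
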